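/- arXiv:1802.10340 — 2 statements merged into one kernel-verified Lean document; each statement's English description precedes it below -/
import Mathlib

section
/- Let $c_v > 0$, $\gamma = 1 + 1/c_v$ and $\Theta > 0$. Then the function $H_\Theta(\varrho, p) = c_v p - \Theta\, c_v\, \varrho \log\big(p/\varrho^{\gamma}\big)$ is strictly convex on the open convex set $(0,\infty)^2$. -/
/-- Tangent-plane inequality for the relative entropy density `x log (x / y)`. -/
theorem relEntropy_tangent_le {x y X Y : ℝ} (hx : 0 < x) (hy : 0 < y) (hX : 0 < X) (hY : 0 < Y) :
    x * (Real.log X - Real.log Y) + x - y * (X / Y) ≤ x * (Real.log x - Real.log y) := by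
  have h := Real.log_le_sub_one_of_pos (show 0 < y * X / (x * Y) by positivity)
  rw [Real.log_div (by positivity) (by positivity), Real.log_mul hy.ne' hX.ne',
    Real.log_mul hx.ne' hY.ne'] at h
  have h2 := mul_le_mul_of_nonneg_left h hx.le
  have e : x * (y * X / (x * Y) - 1) = y * (X / Y) - x := by field_simp
  linarith

/-- Joint convexity of the relative entropy density `x log (x / y)` on the open quadrant. -/
theorem convexOn_relEntropy :
    ConvexOn ℝ (Set.Ioi (0 : ℝ) ×ˢ Set.Ioi (0 : ℝ))
      (fun q : ℝ × ℝ => q.1 * (Real.log q.1 - Real.log q.2)) := by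
  refine ⟨(convex_Ioi 0).prod (convex_Ioi 0), ?_⟩
  rintro ⟨x₁, y₁⟩ ⟨hx₁, hy₁⟩ ⟨x₂, y₂⟩ ⟨hx₂, hy₂⟩ a b ha hb hab
  simp only [Set.mem_Ioi] at hx₁ hy₁ hx₂ hy₂
  have hX : 0 < a * x₁ + b * x₂ := convex_Ioi (0 : ℝ) hx₁ hx₂ ha hb hab
  have hY : 0 < a * y₁ + b * y₂ := convex_Ioi (0 : ℝ) hy₁ hy₂ ha hb hab
  have h₁ := mul_le_mul_of_nonneg_left (relEntropy_tangent_le hx₁ hy₁ hX hY) ha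
  have h₂ := mul_le_mul_of_nonneg_left (relEntropy_tangent_le hx₂ hy₂ hX hY) hb
  have e : (a * y₁ + b * y₂) * ((a * x₁ + b * x₂) / (a * y₁ + b * y₂)) = a * x₁ + b * x₂ :=
    mul_div_cancel₀ _ hY.ne'
  simp only [Prod.smul_mk, Prod.mk_add_mk, smul_eq_mul]
  linarith

/-- For `c_v > 0`, `γ = 1 + 1/c_v`, `Θ > 0`, the function
`H_Θ(ϱ, p) = c_v p - Θ c_v ϱ log (p / ϱ^γ)` is strictly convex on `(0,∞)²`. -/
theorem stmt_7 (c_v Θ : ℝ) (hc_v : 0 < c_v) (hΘ : 0 < Θ)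
    (γ : ℝ) (hγ : γ = 1 + 1 / c_v) :
    StrictConvexOn ℝ (Set.Ioi (0 : ℝ) ×ˢ Set.Ioi (0 : ℝ))
      (fun q : ℝ × ℝ => c_v * q.2 - Θ * c_v * q.1 * Real.log (q.2 / q.1 ^ γ)) := by
  have key : ∀ x y : ℝ, 0 < x → 0 < y →
      c_v * y - Θ * c_v * x * Real.log (y / x ^ γ) =
        c_v * y + Θ * c_v * (x * (Real.log x - Real.log y)) + Θ * (x * Real.log x) := by
    intro x y hx hy
    rw [Real.log_div hy.ne' (Real.rpow_pos_of_pos hx γ).ne', Real.log_rpow hx, hγ]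
    field_simp
    ring
  refine ⟨(convex_Ioi 0).prod (convex_Ioi 0), ?_⟩
  rintro ⟨x₁, y₁⟩ ⟨hx₁, hy₁⟩ ⟨x₂, y₂⟩ ⟨hx₂, hy₂⟩ hne a b ha hb hab
  simp only [Set.mem_Ioi] at hx₁ hy₁ hx₂ hy₂
  have hX : 0 < a * x₁ + b * x₂ := by positivity
  have hY : 0 < a * y₁ + b * y₂ := by positivity
  simp only [Prod.smul_mk, Prod.mk_add_mk, smul_eq_mul]
  rw [key _ _ hX hY, key _ _ hx₁ hy₁, key _ _ hx₂ hy₂]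
  by_cases hx : x₁ = x₂
  · subst hx
    have hy : y₁ ≠ y₂ := fun h => hne (by rw [h])
    have hlog := strictConcaveOn_log_Ioi.2 hy₁ hy₂ hy ha hb hab
    simp only [smul_eq_mul] at hlog
    have h := mul_lt_mul_of_pos_left hlog (show 0 < Θ * c_v * x₁ by positivity)
    obtain rfl : b = 1 - a := by linarith
    have e : a * x₁ + (1 - a) * x₁ = x₁ := by ring
    rw [e]
    linarith
  · have hE := convexOn_relEntropy.2 (Set.mk_mem_prod hx₁ hy₁) (Set.mk_mem_prod hx₂ hy₂)
      ha.le hb.le hab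
    have hS := Real.strictConvexOn_mul_log.2 hx₁.le hx₂.le hx ha hb hab
    simp only [Prod.smul_mk, Prod.mk_add_mk, smul_eq_mul] at hE hS
    have h₁ := mul_le_mul_of_nonneg_left hE (show 0 ≤ Θ * c_v by positivity)
    have h₂ := mul_lt_mul_of_pos_left hS hΘ
    linarith
end

section
/- Let $c_v > 0$, $\gamma = 1 + 1/c_v$, define $H_\Theta(\varrho, p) = c_v p - \Theta\, c_v\, \varrho \log(p/\varrho^{\gamma})$ for $\varrho, p > 0$, and let $K \subset (0,\infty)^2$ be compact. Then there exist $\delta > 0$ and $c > 0$ such that for every $(r, \Theta) \in K$ and every $(\varrho, p) \in (0,\infty)^2$ with $|\varrho - r| + |p - r\Theta| \le \delta$, $H_\Theta(\varrho, p) - H_\Theta(r, r\Theta) - \partial_\varrho H_\Theta(r, r\Theta)\,(\varrho - r) - \partial_p H_\Theta(r, r\Theta)\,(p - r\Theta) \ \ge\ c\,\big(|\varrho - r|^2 + |p - r\Theta|^2\big)$. -/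
/-- `H_Θ(ϱ, p) = c_v p - Θ c_v ϱ log (p / ϱ^γ)`. -/
noncomputable def Hfun (c_v γ Θ ϱ p : ℝ) : ℝ :=
  c_v * p - Θ * c_v * ϱ * Real.log (p / ϱ ^ γ)

/-- The Bregman divergence of `H_Θ` at the point `(r, rΘ)`. -/
noncomputable def Breg (c_v γ Θ r ϱ p : ℝ) : ℝ :=
  Hfun c_v γ Θ ϱ p - Hfun c_v γ Θ r (r * Θ)
    - deriv (fun ϱ' => Hfun c_v γ Θ ϱ' (r * Θ)) r * (ϱ - r)
    - deriv (fun p' => Hfun c_v γ Θ r p') (r * Θ) * (p - r * Θ)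

/-- Quadratic lower bound for the generalized Kullback-Leibler divergence of two positive numbers. -/
theorem sq_sub_div_le_mul_log_div {a b : ℝ} (ha : 0 < a) (hb : 0 < b) :
    (a - b) ^ 2 / (2 * (a + b)) ≤ a * Real.log (a / b) - a + b := by
  obtain ⟨s, hs, rfl⟩ : ∃ s : ℝ, 0 < s ∧ s ^ 2 = a := ⟨√a, Real.sqrt_pos.2 ha, Real.sq_sqrt ha.le⟩
  obtain ⟨t, ht, rfl⟩ : ∃ t : ℝ, 0 < t ∧ t ^ 2 = b := ⟨√b, Real.sqrt_pos.2 hb, Real.sq_sqrt hb.le⟩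
  have hlog : 2 * (s ^ 2 - s * t) ≤ s ^ 2 * Real.log (s ^ 2 / t ^ 2) := by
    have h := Real.one_sub_inv_le_log_of_pos (div_pos hs ht)
    rw [← div_pow, Real.log_pow]
    calc 2 * (s ^ 2 - s * t) = s ^ 2 * (2 * (1 - (s / t)⁻¹)) := by field_simp
      _ ≤ s ^ 2 * ((2 : ℕ) * Real.log (s / t)) := by push_cast; gcongr
  have hsq : (s ^ 2 - t ^ 2) ^ 2 / (2 * (s ^ 2 + t ^ 2)) ≤ (s - t) ^ 2 := by
    rw [div_le_iff₀ (by positivity)]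
    nlinarith [mul_nonneg (sq_nonneg (s - t)) (sq_nonneg (s - t))]
  linarith

theorem Hfun_eq {c_v γ Θ ϱ p : ℝ} (hc : c_v ≠ 0) (hγ : γ = 1 + 1 / c_v) (hϱ : 0 < ϱ) (hp : 0 < p) :
    Hfun c_v γ Θ ϱ p =
      c_v * p - Θ * c_v * (ϱ * Real.log p) + Θ * (c_v + 1) * (ϱ * Real.log ϱ) := by
  have h : c_v * γ = c_v + 1 := by rw [hγ]; field_simp
  rw [Hfun, Real.log_div hp.ne' (Real.rpow_pos_of_pos hϱ γ).ne', Real.log_rpow hϱ, ← h]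
  ring

theorem hasDerivAt_Hfun_density {c_v γ Θ ϱ p : ℝ} (hc : c_v ≠ 0) (hγ : γ = 1 + 1 / c_v)
    (hϱ : 0 < ϱ) (hp : 0 < p) :
    HasDerivAt (fun ϱ' => Hfun c_v γ Θ ϱ' p)
      (-(Θ * c_v * Real.log p) + Θ * (c_v + 1) * (Real.log ϱ + 1)) ϱ := by
  have h := ((((hasDerivAt_id ϱ).mul_const (Real.log p)).const_mul (Θ * c_v)).const_sub
    (c_v * p)).add ((Real.hasDerivAt_mul_log hϱ.ne').const_mul (Θ * (c_v + 1)))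
  refine (h.congr_deriv (by ring)).congr_of_eventuallyEq ?_
  filter_upwards [lt_mem_nhds hϱ] with x hx
  simpa using Hfun_eq hc hγ hx hp

theorem hasDerivAt_Hfun_pressure {c_v γ Θ ϱ p : ℝ} (hc : c_v ≠ 0) (hγ : γ = 1 + 1 / c_v)
    (hϱ : 0 < ϱ) (hp : 0 < p) :
    HasDerivAt (fun p' => Hfun c_v γ Θ ϱ p') (c_v - Θ * c_v * (ϱ / p)) p := by
  have h := (((hasDerivAt_id p).const_mul c_v).sub
    (((Real.hasDerivAt_log hp.ne').const_mul ϱ).const_mul (Θ * c_v))).add_const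
      (Θ * (c_v + 1) * (ϱ * Real.log ϱ))
  refine (h.congr_deriv (by rw [div_eq_mul_inv]; ring)).congr_of_eventuallyEq ?_
  filter_upwards [lt_mem_nhds hp] with x hx
  simpa using Hfun_eq hc hγ hϱ hx

/-- The Bregman divergence of `H_Θ` is a positive combination of two Kullback-Leibler terms. -/
theorem Breg_eq {c_v γ Θ r ϱ p : ℝ} (hc : c_v ≠ 0) (hγ : γ = 1 + 1 / c_v) (hΘ : 0 < Θ)
    (hr : 0 < r) (hϱ : 0 < ϱ) (hp : 0 < p) :
    Breg c_v γ Θ r ϱ p = c_v * (Θ * ϱ * Real.log (Θ * ϱ / p) - Θ * ϱ + p)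
      + Θ * (ϱ * Real.log (ϱ / r) - ϱ + r) := by
  have hrΘ : 0 < r * Θ := mul_pos hr hΘ
  rw [Breg, (hasDerivAt_Hfun_density hc hγ hr hrΘ).deriv,
    (hasDerivAt_Hfun_pressure hc hγ hr hrΘ).deriv, Hfun_eq hc hγ hϱ hp, Hfun_eq hc hγ hr hrΘ,
    Real.log_div (mul_pos hΘ hϱ).ne' hp.ne', Real.log_div hϱ.ne' hr.ne',
    Real.log_mul hΘ.ne' hϱ.ne', Real.log_mul hr.ne' hΘ.ne']
  field_simp
  ring

/-- Coercivity of the essential part of the relative energy: near a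
compact set `K ⊂ (0,∞)²` of test states `(r, Θ)`, the Bregman divergence of `H_Θ`
at `(r, rΘ)` dominates the squared distance `|ϱ - r|² + |p - rΘ|²`, uniformly in
`(r, Θ) ∈ K`. -/
theorem stmt_8 (c_v : ℝ) (hc_v : 0 < c_v) (γ : ℝ) (hγ : γ = 1 + 1 / c_v)
    (K : Set (ℝ × ℝ)) (hK : IsCompact K)
    (hKsub : K ⊆ Set.Ioi (0 : ℝ) ×ˢ Set.Ioi (0 : ℝ)) :
    ∃ δ > 0, ∃ c > 0, ∀ rΘ ∈ K, ∀ ϱ p : ℝ, 0 < ϱ → 0 < p →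
      |ϱ - rΘ.1| + |p - rΘ.1 * rΘ.2| ≤ δ →
      c * (|ϱ - rΘ.1| ^ 2 + |p - rΘ.1 * rΘ.2| ^ 2)
        ≤ Breg c_v γ rΘ.2 rΘ.1 ϱ p := by
  obtain ⟨m, hm, hmK⟩ := hK.exists_forall_le' (f := Prod.snd) continuousOn_snd
    (a := (0 : ℝ)) fun x hx => (hKsub hx).2
  obtain ⟨M₁, hM₁⟩ := hK.bddAbove_image (f := Prod.fst) continuousOn_fst
  obtain ⟨M₂, hM₂⟩ := hK.bddAbove_image (f := Prod.snd) continuousOn_snd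
  obtain ⟨M, hM, hMr, hMΘ⟩ : ∃ M : ℝ, 0 < M ∧ (∀ x ∈ K, x.1 ≤ M) ∧ ∀ x ∈ K, x.2 ≤ M :=
    ⟨max 1 (max M₁ M₂), by positivity,
      fun x hx => (hM₁ ⟨x, hx, rfl⟩).trans (by simp),
      fun x hx => (hM₂ ⟨x, hx, rfl⟩).trans (by simp)⟩
  obtain ⟨B, hB, hB₁, hB₂⟩ : ∃ B : ℝ, 0 < B ∧ 2 * (M * (M + 1) + (M * M + 1)) ≤ B ∧
      2 * (M + 1 + M) ≤ B :=
    ⟨max (2 * (M * (M + 1) + (M * M + 1))) (2 * (M + 1 + M)), by positivity,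
      le_max_left _ _, le_max_right _ _⟩
  set κ := min (c_v / B) (m / B)
  have hκ0 : 0 < κ := lt_min (by positivity) (by positivity)
  refine ⟨1, one_pos, κ / (2 + 2 * M ^ 2), by positivity, ?_⟩
  rintro ⟨r, Θ⟩ hx ϱ p hϱ hp hdist
  have hr : 0 < r := (hKsub hx).1
  have hΘ : 0 < Θ := (hKsub hx).2
  have hmΘ : m ≤ Θ := hmK _ hx
  replace hMr : r ≤ M := hMr _ hx
  replace hMΘ : Θ ≤ M := hMΘ _ hx
  simp only [sq_abs] at hdist ⊢
  have hϱM : ϱ ≤ M + 1 := by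
    linarith [le_abs_self (ϱ - r), abs_nonneg (p - r * Θ)]
  have hpM : p ≤ M * M + 1 := by
    have : r * Θ ≤ M * M := by gcongr
    linarith [le_abs_self (p - r * Θ), abs_nonneg (ϱ - r)]
  have h₁ : κ * (Θ * ϱ - p) ^ 2 ≤ c_v * (Θ * ϱ * Real.log (Θ * ϱ / p) - Θ * ϱ + p) := by
    have hle : 2 * (Θ * ϱ + p) ≤ B := by
      refine le_trans ?_ hB₁
      gcongr
    calc κ * (Θ * ϱ - p) ^ 2 ≤ c_v / B * (Θ * ϱ - p) ^ 2 := by gcongr; exact min_le_left _ _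
      _ = c_v * ((Θ * ϱ - p) ^ 2 / B) := by ring
      _ ≤ c_v * ((Θ * ϱ - p) ^ 2 / (2 * (Θ * ϱ + p))) := by gcongr
      _ ≤ _ := by gcongr; exact sq_sub_div_le_mul_log_div (mul_pos hΘ hϱ) hp
  have h₂ : κ * (ϱ - r) ^ 2 ≤ Θ * (ϱ * Real.log (ϱ / r) - ϱ + r) := by
    have hle : 2 * (ϱ + r) ≤ B := by linarith
    calc κ * (ϱ - r) ^ 2 ≤ m / B * (ϱ - r) ^ 2 := by gcongr; exact min_le_right _ _
      _ = m * ((ϱ - r) ^ 2 / B) := by ring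
      _ ≤ Θ * ((ϱ - r) ^ 2 / (2 * (ϱ + r))) := by gcongr
      _ ≤ _ := by gcongr; exact sq_sub_div_le_mul_log_div hϱ hr
  have hquad : (ϱ - r) ^ 2 + (p - r * Θ) ^ 2 ≤
      (2 + 2 * M ^ 2) * ((Θ * ϱ - p) ^ 2 + (ϱ - r) ^ 2) := by
    have hΘsq : Θ ^ 2 * (ϱ - r) ^ 2 ≤ M ^ 2 * (ϱ - r) ^ 2 := by gcongr
    have hpar : (p - r * Θ) ^ 2 ≤ 2 * (Θ ^ 2 * (ϱ - r) ^ 2) + 2 * (Θ * ϱ - p) ^ 2 := by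
      nlinarith [sq_nonneg (Θ * (ϱ - r) + (Θ * ϱ - p))]
    nlinarith [sq_nonneg (ϱ - r), mul_nonneg (sq_nonneg M) (sq_nonneg (Θ * ϱ - p))]
  calc κ / (2 + 2 * M ^ 2) * ((ϱ - r) ^ 2 + (p - r * Θ) ^ 2)
      ≤ κ / (2 + 2 * M ^ 2) * ((2 + 2 * M ^ 2) * ((Θ * ϱ - p) ^ 2 + (ϱ - r) ^ 2)) := by gcongr
    _ = κ * (Θ * ϱ - p) ^ 2 + κ * (ϱ - r) ^ 2 := by field_simp
    _ ≤ Breg c_v γ Θ r ϱ p := by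
      rw [Breg_eq hc_v.ne' hγ hΘ hr hϱ hp]
      exact add_le_add h₁ h₂
end
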